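/- Let 0 < a < π/(2√2), let Δ = Δ_sq(a) be the square lattice 2aℤ × 2aℤ, and let Λ = 4aℤ × 4aℤ × 2πℤ ⊂ ℝ³. Then the infimum of L_Δ(γ) over all nonzero v ∈ Λ, all m ∈ ℝ³ and all piecewise C¹ curves γ : [0,1] → ℝ³ with γ(0) = m and γ(1) = m + v equals min( 4a , 2π·cos(a√2) ). (This is the systole of the singular torus (T, g_c) = (ℝ³, h)/Λ.) -/

import Mathlib

open Real MeasureTheory Set

noncomputable section

/-- The point `(x, y)` of the Euclidean plane. -/
def pt2 (x y : ℝ) : EuclideanSpace ℝ (Fin 2) := (WithLp.equiv 2 (Fin 2 → ℝ)).symm ![x, y]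

/-- `f : [0,1] → ℝ` is piecewise `C¹`. -/
def PC1 (f : ℝ → ℝ) : Prop :=
  ∃ (n : ℕ) (t : ℕ → ℝ), t 0 = 0 ∧ t n = 1 ∧ (∀ i < n, t i < t (i + 1)) ∧
    ContinuousOn f (Set.Icc 0 1) ∧ ∀ i < n, ContDiffOn ℝ 1 f (Set.Icc (t i) (t (i + 1)))

/-- Length of `γ = (γ₁,γ₂,γ₃)` for the singular metric
`h = dx² + dy² + cos²(dist((x,y),Δ)) dz²`. -/
def sLen (Δ : Set (EuclideanSpace ℝ (Fin 2))) (γ₁ γ₂ γ₃ : ℝ → ℝ) : ℝ :=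
  ∫ t in (0:ℝ)..1, Real.sqrt ((deriv γ₁ t) ^ 2 + (deriv γ₂ t) ^ 2 +
    Real.cos (Metric.infDist (pt2 (γ₁ t) (γ₂ t)) Δ) ^ 2 * (deriv γ₃ t) ^ 2)

/-- The square lattice `Δ_sq(a) = 2aℤ × 2aℤ ⊂ ℝ²`. -/
def ΔsqE (a : ℝ) : Set (EuclideanSpace ℝ (Fin 2)) :=
  {p | ∃ m n : ℤ, p = pt2 (2 * a * m) (2 * a * n)}

theorem PC1.intervalIntegrable_deriv_and_integral_deriv {f : ℝ → ℝ} (hf : PC1 f) :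
    IntervalIntegrable (deriv f) volume 0 1 ∧ ∫ t in (0:ℝ)..1, deriv f t = f 1 - f 0 := by
  obtain ⟨n, t, h0, h1, hlt, -, hC⟩ := hf
  have hint : ∀ i < n, IntervalIntegrable (deriv f) volume (t i) (t (i + 1)) := by
    intro i hi
    have hcont : ContinuousOn (derivWithin f (Icc (t i) (t (i + 1)))) (Icc (t i) (t (i + 1))) :=
      (hC i hi).continuousOn_derivWithin (uniqueDiffOn_Icc (hlt i hi)) le_rfl
    refine (hcont.intervalIntegrable_of_Icc (hlt i hi).le).congr_uIoo fun x hx => ?_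
    rw [uIoo_of_le (hlt i hi).le] at hx
    exact derivWithin_of_mem_nhds (Icc_mem_nhds hx.1 hx.2)
  rw [← h0, ← h1]
  refine ⟨IntervalIntegrable.trans_iterate hint, ?_⟩
  rw [← intervalIntegral.sum_integral_adjacent_intervals hint,
    ← Finset.sum_range_sub (fun i => f (t i)) n]
  refine Finset.sum_congr rfl fun i hi => ?_
  have hi := Finset.mem_range.1 hi
  exact intervalIntegral.integral_deriv_of_contDiffOn_Icc (hC i hi) (hlt i hi).le

theorem PC1.continuousOn {f : ℝ → ℝ} (hf : PC1 f) : ContinuousOn f (Icc 0 1) := by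
  obtain ⟨-, -, -, -, -, h, -⟩ := hf
  exact h

theorem PC1.abs_sub_le_integral_abs_deriv {f : ℝ → ℝ} (hf : PC1 f) :
    |f 1 - f 0| ≤ ∫ t in (0:ℝ)..1, |deriv f t| := by
  rw [← hf.intervalIntegrable_deriv_and_integral_deriv.2]
  exact intervalIntegral.abs_integral_le_integral_abs zero_le_one

theorem ContDiff.pc1 {f : ℝ → ℝ} (hf : ContDiff ℝ 1 f) : PC1 f :=
  ⟨1, fun i => i, by simp, by simp, by simp, hf.continuous.continuousOn,
    fun _ _ => hf.contDiffOn⟩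

theorem dist_pt2 (x y x' y' : ℝ) :
    dist (pt2 x y) (pt2 x' y') = √((x - x') ^ 2 + (y - y') ^ 2) := by
  simp [pt2, EuclideanSpace.dist_eq, Fin.sum_univ_two, Real.dist_eq, sq_abs]

theorem continuous_pt2 : Continuous fun p : ℝ × ℝ => pt2 p.1 p.2 := by
  unfold pt2
  refine (PiLp.continuous_toLp 2 _).comp (continuous_pi fun i => ?_)
  fin_cases i
  · exact continuous_fst
  · exact continuous_snd

theorem exists_int_sq_sub_le {a : ℝ} (ha : 0 < a) (x : ℝ) :
    ∃ m : ℤ, (x - 2 * a * m) ^ 2 ≤ a ^ 2 := by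
  refine ⟨round (x / (2 * a)), sq_le_sq' ?_ ?_⟩ <;>
  · have h := abs_le.1 (abs_sub_round (x / (2 * a)))
    have hx : x = 2 * a * (x / (2 * a)) := by field_simp
    nlinarith [h.1, h.2]

theorem infDist_ΔsqE_le {a : ℝ} (ha : 0 < a) (x y : ℝ) :
    Metric.infDist (pt2 x y) (ΔsqE a) ≤ a * √2 := by
  obtain ⟨m, hm⟩ := exists_int_sq_sub_le ha x
  obtain ⟨n, hn⟩ := exists_int_sq_sub_le ha y
  refine (Metric.infDist_le_dist_of_mem 
    (show pt2 (2 * a * m) (2 * a * n) ∈ ΔsqE a from ⟨m, n, rfl⟩)).trans ?_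
  rw [dist_pt2]
  refine Real.sqrt_le_iff.2 ⟨by positivity, ?_⟩
  rw [mul_pow, Real.sq_sqrt zero_le_two]
  linarith

theorem infDist_ΔsqE_center {a : ℝ} (ha : 0 < a) :
    Metric.infDist (pt2 a a) (ΔsqE a) = a * √2 := by
  refine le_antisymm (infDist_ΔsqE_le ha a a) ?_
  have hodd : ∀ m : ℤ, a ^ 2 ≤ (a - 2 * a * m) ^ 2 := by
    intro m
    have h : (1 : ℤ) ≤ (1 - 2 * m) ^ 2 := by
      have : (1 - 2 * m) ^ 2 ≠ 0 := pow_ne_zero 2 (by omega)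
      have := sq_nonneg (1 - 2 * m)
      omega
    have h' : (1 : ℝ) ≤ (1 - 2 * m) ^ 2 := by exact_mod_cast h
    nlinarith [sq_nonneg a]
  refine (Metric.le_infDist (s := ΔsqE a) ⟨_, 0, 0, rfl⟩).2 ?_
  rintro _ ⟨m, n, rfl⟩
  rw [dist_pt2]
  refine Real.le_sqrt_of_sq_le ?_
  rw [mul_pow, Real.sq_sqrt zero_le_two]
  linarith [hodd m, hodd n]

theorem intervalIntegrable_sLen (Δ : Set (EuclideanSpace ℝ (Fin 2))) {γ₁ γ₂ γ₃ : ℝ → ℝ}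
    (h₁ : PC1 γ₁) (h₂ : PC1 γ₂) (h₃ : PC1 γ₃) :
    IntervalIntegrable (fun t => √((deriv γ₁ t) ^ 2 + (deriv γ₂ t) ^ 2 +
      Real.cos (Metric.infDist (pt2 (γ₁ t) (γ₂ t)) Δ) ^ 2 * (deriv γ₃ t) ^ 2)) volume 0 1 := by
  have i₁ := h₁.intervalIntegrable_deriv_and_integral_deriv.1.abs
  have i₂ := h₂.intervalIntegrable_deriv_and_integral_deriv.1.abs
  have i₃ := h₃.intervalIntegrable_deriv_and_integral_deriv.1.abs
  refine ((i₁.add i₂).add i₃).mono_fun' ?_ ?_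
  · have hc : ContinuousOn (fun t => Real.cos (Metric.infDist (pt2 (γ₁ t) (γ₂ t)) Δ))
        (Icc 0 1) :=
      Real.continuous_cos.comp_continuousOn ((Metric.continuous_infDist_pt Δ).comp_continuousOn
        (continuous_pt2.comp_continuousOn (h₁.continuousOn.prodMk h₂.continuousOn)))
    have hm : AEMeasurable (fun t => Real.cos (Metric.infDist (pt2 (γ₁ t) (γ₂ t)) Δ))
        (volume.restrict (uIoc 0 1)) := by
      rw [uIoc_of_le zero_le_one]
      exact (hc.mono Ioc_subset_Icc_self).aemeasurable measurableSet_Ioc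
    have m₁ := (measurable_deriv γ₁).aemeasurable (μ := volume.restrict (uIoc 0 1))
    have m₂ := (measurable_deriv γ₂).aemeasurable (μ := volume.restrict (uIoc 0 1))
    have m₃ := (measurable_deriv γ₃).aemeasurable (μ := volume.restrict (uIoc 0 1))
    exact (((m₁.pow_const 2).add (m₂.pow_const 2)).add
      ((hm.pow_const 2).mul (m₃.pow_const 2))).sqrt.aestronglyMeasurable
  · refine Filter.Eventually.of_forall fun t => ?_
    simp only [Real.norm_eq_abs, abs_of_nonneg (Real.sqrt_nonneg _)]
    refine Real.sqrt_le_iff.2 ⟨by positivity, ?_⟩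
    have hc := mul_le_of_le_one_left (sq_nonneg (deriv γ₃ t))
      (Real.cos_sq_le_one (Metric.infDist (pt2 (γ₁ t) (γ₂ t)) Δ))
    rw [← sq_abs (deriv γ₁ t), ← sq_abs (deriv γ₂ t)]
    rw [← sq_abs (deriv γ₃ t)] at hc ⊢
    nlinarith [mul_nonneg (abs_nonneg (deriv γ₁ t)) (abs_nonneg (deriv γ₂ t)),
      mul_nonneg (abs_nonneg (deriv γ₁ t)) (abs_nonneg (deriv γ₃ t)),
      mul_nonneg (abs_nonneg (deriv γ₂ t)) (abs_nonneg (deriv γ₃ t))]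

theorem mul_abs_sub_le_sLen (Δ : Set (EuclideanSpace ℝ (Fin 2))) {γ₁ γ₂ γ₃ f : ℝ → ℝ}
    (h₁ : PC1 γ₁) (h₂ : PC1 γ₂) (h₃ : PC1 γ₃) (hf : PC1 f) {c : ℝ} (hc : 0 ≤ c)
    (h : ∀ t, (c * deriv f t) ^ 2 ≤ (deriv γ₁ t) ^ 2 + (deriv γ₂ t) ^ 2 +
      Real.cos (Metric.infDist (pt2 (γ₁ t) (γ₂ t)) Δ) ^ 2 * (deriv γ₃ t) ^ 2) :
    c * |f 1 - f 0| ≤ sLen Δ γ₁ γ₂ γ₃ := by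
  refine (mul_le_mul_of_nonneg_left hf.abs_sub_le_integral_abs_deriv hc).trans ?_
  rw [← intervalIntegral.integral_const_mul]
  refine intervalIntegral.integral_mono_on zero_le_one
    (hf.intervalIntegrable_deriv_and_integral_deriv.1.abs.const_mul c)
    (intervalIntegrable_sLen Δ h₁ h₂ h₃) fun t _ => ?_
  rw [← abs_of_nonneg hc, ← abs_mul]
  exact Real.abs_le_sqrt (h t)

/-- for `0 < a < π/(2√2)`, `Δ = Δ_sq(a)` and `Λ = 4aℤ × 4aℤ × 2πℤ`, the infimum
of `L_Δ(γ)` over all nonzero `v ∈ Λ`, all `m ∈ ℝ³` and all piecewise `C¹` curves `γ` from `m`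
to `m + v` equals `min(4a, 2π cos(a√2))`: the systole of the singular torus `(T, g_c)`. -/
theorem systole_singular_square_torus (a : ℝ) (ha : 0 < a)
    (ha' : a < π / (2 * Real.sqrt 2)) :
    sInf {L : ℝ | ∃ (k₁ k₂ k₃ : ℤ) (γ₁ γ₂ γ₃ : ℝ → ℝ),
        ¬(k₁ = 0 ∧ k₂ = 0 ∧ k₃ = 0) ∧ PC1 γ₁ ∧ PC1 γ₂ ∧ PC1 γ₃ ∧
        γ₁ 1 = γ₁ 0 + 4 * a * k₁ ∧ γ₂ 1 = γ₂ 0 + 4 * a * k₂ ∧ γ₃ 1 = γ₃ 0 + 2 * π * k₃ ∧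
        L = sLen (ΔsqE a) γ₁ γ₂ γ₃} =
      min (4 * a) (2 * π * Real.cos (a * Real.sqrt 2)) := by
  have hs : a * √2 < π / 2 := by
    rw [lt_div_iff₀ (by positivity)] at ha'
    linarith
  have hpos : 0 < Real.cos (a * √2) :=
    Real.cos_pos_of_mem_Ioo ⟨by linarith [Real.pi_pos, mul_pos ha (Real.sqrt_pos.2 two_pos)], hs⟩
  have hone : ∀ k : ℤ, k ≠ 0 → (1 : ℝ) ≤ |(k : ℝ)| := fun k hk => by
    exact_mod_cast Int.one_le_abs hk
  have hconst : ∀ c : ℝ, PC1 fun _ => c := fun c => ContDiff.pc1 contDiff_const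
  have hlin : ∀ c : ℝ, PC1 fun t => c * t :=
    fun c => ContDiff.pc1 (contDiff_const.mul contDiff_id)
  refine IsLeast.csInf_eq ⟨?_, ?_⟩
  · rcases min_choice (4 * a) (2 * π * Real.cos (a * √2)) with h | h <;> rw [h]
    · refine ⟨1, 0, 0, fun t => 4 * a * t, fun _ => 0, fun _ => 0, by simp, hlin _, hconst _,
        hconst _, by simp, by simp, by simp, ?_⟩
      simp [sLen, Real.sqrt_sq, ha.le]
    · refine ⟨0, 0, 1, fun _ => a, fun _ => a, fun t => 2 * π * t, by simp, hconst _, hconst _,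
        hlin _, by simp, by simp, by simp, ?_⟩
      have hd : deriv (fun t : ℝ => 2 * π * t) = fun _ => 2 * π := by
        ext t
        simp
      simp only [sLen, infDist_ΔsqE_center ha, deriv_const, hd, ← mul_pow]
      rw [zero_pow two_ne_zero, zero_add, zero_add, Real.sqrt_sq (by positivity)]
      simp [mul_comm]
  · rintro _ ⟨k₁, k₂, k₃, γ₁, γ₂, γ₃, hk, h₁, h₂, h₃, e₁, e₂, e₃, rfl⟩
    have hbound {f : ℝ → ℝ} (hf : PC1 f) {c d : ℝ} (hc : 0 ≤ c) (hd : 0 ≤ d) {k : ℤ} (hk : k ≠ 0)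
        (e : f 1 = f 0 + d * k)
        (h : ∀ t, (c * deriv f t) ^ 2 ≤ (deriv γ₁ t) ^ 2 + (deriv γ₂ t) ^ 2 +
          Real.cos (Metric.infDist (pt2 (γ₁ t) (γ₂ t)) (ΔsqE a)) ^ 2 * (deriv γ₃ t) ^ 2) :
        d * c ≤ sLen (ΔsqE a) γ₁ γ₂ γ₃ := by
      refine le_trans ?_ (mul_abs_sub_le_sLen (ΔsqE a) h₁ h₂ h₃ hf hc h)
      rw [e, add_sub_cancel_left, abs_mul, abs_of_nonneg hd]
      nlinarith [mul_nonneg (mul_nonneg hc hd) (sub_nonneg.2 (hone k hk))]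
    by_cases hk₁ : k₁ = 0
    · by_cases hk₂ : k₂ = 0
      · have hk₃ : k₃ ≠ 0 := fun h => hk ⟨hk₁, hk₂, h⟩
        refine (min_le_right _ _).trans (hbound h₃ hpos.le (by positivity) hk₃ e₃ fun t => ?_)
        have hcos := Real.cos_le_cos_of_nonneg_of_le_pi
          (Metric.infDist_nonneg (x := pt2 (γ₁ t) (γ₂ t)) (s := ΔsqE a))
          (by linarith [Real.pi_pos]) (infDist_ΔsqE_le ha (γ₁ t) (γ₂ t))
        rw [mul_pow]
        have := mul_le_mul_of_nonneg_right (pow_le_pow_left₀ hpos.le hcos 2)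
          (sq_nonneg (deriv γ₃ t))
        linarith [sq_nonneg (deriv γ₁ t), sq_nonneg (deriv γ₂ t)]
      · refine (min_le_left _ _).trans ?_
        rw [← mul_one (4 * a)]
        refine hbound h₂ zero_le_one (by positivity) hk₂ e₂ fun t => ?_
        rw [one_mul, add_right_comm]
        exact le_add_of_nonneg_left (by positivity)
    · refine (min_le_left _ _).trans ?_
      rw [← mul_one (4 * a)]
      refine hbound h₁ zero_le_one (by positivity) hk₁ e₁ fun t => ?_
      rw [one_mul, add_assoc]
      exact le_add_of_nonneg_right (by positivity)

end
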